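/- (Greedy protocol respects energy conservation and nonnegativity.) For any initial state x(0) ∈ [0, B], the sequences x, g, l produced by the greedy charging protocol satisfy, for all n = 1,…,N: the energy conservation law x(n) = α·x(n−1) + (w(n) − d(n)) + (g(n) − l(n)), together with g(n) ≥ 0 and l(n) ≥ 0. -/

import Mathlib

open Finset

/-- A feasible trajectory for a battery with energy rating `B`, power rating `P`,
loss factor `α`, time step `Δ`, wind `w` and demand `d`, over time horizon `N`:
state `x : {0,…,N} → ℝ`, peaker energy `g` and lost wind energy `l` on `{1,…,N}`. -/
def Feasible (N : ℕ) (Δ α B P : ℝ) (w d : ℕ → ℝ) (x g l : ℕ → ℝ) : Prop :=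
  (∀ n, 1 ≤ n → n ≤ N → 0 ≤ g n) ∧
  (∀ n, 1 ≤ n → n ≤ N → 0 ≤ l n) ∧
  (∀ m, m ≤ N → 0 ≤ x m ∧ x m ≤ B) ∧
  (∀ n, 1 ≤ n → n ≤ N → |x n - α * x (n - 1)| ≤ Δ * P) ∧
  (∀ n, 1 ≤ n → n ≤ N → x n = α * x (n - 1) + (w n - d n) + (g n - l n))

/-- Battery state sequence of the greedy charging protocol:
`x(n)` is `α·x(n−1) + (w n − d n)` clamped to
`[max(0, α·x(n−1) − Δ·P), min(B, α·x(n−1) + Δ·P)]`. -/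
noncomputable def greedyX (Δ α B P : ℝ) (w d : ℕ → ℝ) (x0 : ℝ) : ℕ → ℝ
  | 0 => x0
  | n + 1 =>
      min (min B (α * greedyX Δ α B P w d x0 n + Δ * P))
        (max (max 0 (α * greedyX Δ α B P w d x0 n - Δ * P))
          (α * greedyX Δ α B P w d x0 n + (w (n + 1) - d (n + 1))))

/-- Peaker energy of the greedy charging protocol. -/
noncomputable def greedyG (Δ α B P : ℝ) (w d : ℕ → ℝ) (x0 : ℝ) (n : ℕ) : ℝ :=
  if w n < d n then
    greedyX Δ α B P w d x0 n - α * greedyX Δ α B P w d x0 (n - 1) + (d n - w n)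
  else 0

/-- Lost wind energy of the greedy charging protocol. -/
noncomputable def greedyL (Δ α B P : ℝ) (w d : ℕ → ℝ) (x0 : ℝ) (n : ℕ) : ℝ :=
  if d n < w n then
    -(greedyX Δ α B P w d x0 n - α * greedyX Δ α B P w d x0 (n - 1) + (d n - w n))
  else 0

/-- Clamping `a + e` to `[max 0 (a - r), min B (a + r)]`, where `0 ≤ a ≤ B`, moves it towards `a`:
it does not decrease if `e ≤ 0` and does not increase if `0 ≤ e`. -/
lemma clamp_compare {a B r : ℝ} (ha : 0 ≤ a) (haB : a ≤ B) (hr : 0 ≤ r) (e : ℝ) :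
    (e ≤ 0 → a + e ≤ min (min B (a + r)) (max (max 0 (a - r)) (a + e))) ∧
      (0 ≤ e → min (min B (a + r)) (max (max 0 (a - r)) (a + e)) ≤ a + e) := by
  refine ⟨fun he => ?_, fun he => ?_⟩
  · exact le_min (le_min (by linarith) (by linarith)) (le_max_right _ _)
  · exact (min_le_right _ _).trans
      (max_le (max_le (by linarith) (by linarith)) le_rfl)

/-- The greedy charging protocol keeps the battery state within `[0, B]`. -/
lemma greedyX_mem_Icc {Δ α B P x0 : ℝ} (hB : 0 ≤ B) (hP : 0 ≤ Δ * P) (hα0 : 0 ≤ α)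
    (w d : ℕ → ℝ) (hx0 : 0 ≤ x0) (hx0B : x0 ≤ B) (n : ℕ) :
    greedyX Δ α B P w d x0 n ∈ Set.Icc 0 B := by
  induction n with
  | zero => exact ⟨hx0, hx0B⟩
  | succ n ih =>
    have := mul_nonneg hα0 ih.1
    rw [greedyX]
    exact ⟨le_min (le_min hB (by linarith)) ((le_max_left _ _).trans (le_max_left _ _)),
      (min_le_left _ _).trans (min_le_left _ _)⟩

/-- The greedy charging protocol respects energy conservation and nonnegativity:
for any initial state `x0 ∈ [0, B]` and all `n = 1,…,N`, the produced sequences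
satisfy `x n = α·x (n−1) + (w n − d n) + (g n − l n)`, `g n ≥ 0` and `l n ≥ 0`. -/
theorem stmt13 (N : ℕ) (hN : 1 ≤ N) (Δ : ℝ) (hΔ : 0 < Δ)
    (α B P : ℝ) (hα0 : 0 ≤ α) (hα1 : α ≤ 1) (hB : 0 ≤ B) (hP : 0 ≤ P)
    (w d : ℕ → ℝ) (x0 : ℝ) (hx0 : 0 ≤ x0) (hx0B : x0 ≤ B) :
    ∀ n, 1 ≤ n → n ≤ N →
      greedyX Δ α B P w d x0 n =
          α * greedyX Δ α B P w d x0 (n - 1) + (w n - d n)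
            + (greedyG Δ α B P w d x0 n - greedyL Δ α B P w d x0 n) ∧
      0 ≤ greedyG Δ α B P w d x0 n ∧
      0 ≤ greedyL Δ α B P w d x0 n := by
  intro n hn _
  obtain ⟨k, rfl⟩ := Nat.exists_eq_add_of_le' hn
  obtain ⟨hx, hxB⟩ := greedyX_mem_Icc hB (mul_nonneg hΔ.le hP) hα0 w d hx0 hx0B k
  have ha : 0 ≤ α * greedyX Δ α B P w d x0 k := mul_nonneg hα0 hx
  have haB : α * greedyX Δ α B P w d x0 k ≤ B := (mul_le_of_le_one_left hx hα1).trans hxB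
  have key := clamp_compare ha haB (mul_nonneg hΔ.le hP) (w (k + 1) - d (k + 1))
  rw [← greedyX] at key
  obtain ⟨hle, hge⟩ := key
  simp only [greedyG, greedyL, Nat.add_sub_cancel]
  rcases lt_trichotomy (w (k + 1)) (d (k + 1)) with h | h | h
  · have := hle (by linarith)
    simp only [h, h.not_gt, if_true, if_false]
    refine ⟨by ring, by linarith, le_rfl⟩
  · have h₁ := hle (by linarith)
    have h₂ := hge (by linarith)
    simp only [h, lt_irrefl, if_false]
    refine ⟨by linarith, le_rfl, le_rfl⟩
  · have := hge (by linarith)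
    simp only [h, h.not_gt, if_true, if_false]
    refine ⟨by ring, le_rfl, by linarith⟩
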